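/- Consider the original MILP and semi-coarse model as in the context, and let Z_MILP and Z_semi be the sets of objective values attained at MILP-feasible and semi-coarse feasible points, respectively. If Z_semi is nonempty and Z_MILP is bounded below, then sInf Z_MILP ≤ sInf Z_semi; that is, the optimal value of the semi-coarse model is an upper bound on the optimal value of the original MILP. -/

import Mathlib

open Finset Matrix

/-- Pairing a blockwise combination of profiles with a vector is the combination of the
blockwise pairings. -/
lemma sum_mul_profile_combination {ι η κ R : Type*} [Fintype ι] [Fintype η] [Fintype κ]
    [CommSemiring R] (g : ι × η → R) (u : ι → κ → R) (X : κ → η → R) :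
    ∑ p, g p * ∑ k, u p.1 k * X k p.2 = ∑ i, ∑ k, u i k * ∑ h, g (i, h) * X k h := by
  rw [Fintype.sum_prod_type]
  refine Finset.sum_congr rfl fun i _ => ?_
  simp only [Finset.mul_sum]
  rw [Finset.sum_comm]
  exact Finset.sum_congr rfl fun k _ => Finset.sum_congr rfl fun h _ => by ring

/-- The variant of `sum_mul_profile_combination` for a doubly indexed family of profiles. -/
lemma sum_mul_sigma_profile_combination {ι η κ R : Type*} {τ : κ → Type*} [Fintype ι]
    [Fintype η] [Fintype κ] [∀ k, Fintype (τ k)] [CommSemiring R] (g : ι × η → R)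
    (u : ι → (k : κ) → τ k → R) (V : (k : κ) → τ k → η → R) :
    ∑ p, g p * ∑ k, ∑ j, u p.1 k j * V k j p.2
      = ∑ i, ∑ k, ∑ j, u i k j * ∑ h, g (i, h) * V k j h := by
  simpa only [Fintype.sum_sigma] using
    sum_mul_profile_combination g (fun i (s : Sigma τ) => u i s.1 s.2) (fun s => V s.1 s.2)

/-- A binary vector with coordinate sum at most one vanishes or is a standard basis vector. -/
lemma eq_zero_or_exists_eq_single_of_sum_le_one {κ : Type*} [Fintype κ] [DecidableEq κ]
    {u : κ → ℝ} (hu : ∀ k, u k = 0 ∨ u k = 1) (hsum : ∑ k, u k ≤ 1) :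
    u = 0 ∨ ∃ k, u = Pi.single k 1 := by
  have hnonneg : ∀ k, 0 ≤ u k := fun k => by rcases hu k with h | h <;> simp [h]
  by_cases h0 : ∀ k, u k = 0
  · exact Or.inl (funext h0)
  · push Not at h0
    obtain ⟨k, hk⟩ := h0
    have hk1 : u k = 1 := (hu k).resolve_left hk
    refine Or.inr ⟨k, funext fun l => ?_⟩
    by_cases hlk : l = k
    · subst hlk
      simp [hk1]
    · have hpair : u l + u k ≤ ∑ k, u k := by
        rw [← Finset.sum_pair hlk]
        exact Finset.sum_le_univ_sum_of_nonneg hnonneg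
      rw [Pi.single_eq_of_ne hlk]
      linarith [hnonneg l]

/-- Upper-bound assertion of Proposition 2 of the paper: if the semi-coarse
model is feasible and the MILP objective values are bounded below, then the
optimal value of the semi-coarse model is an upper bound on the optimal value
of the original MILP. -/
theorem semi_coarse_optimal_value_upper_bound
    (m M n δ K J : ℕ) (hm : 0 < m) (hM : 0 < M) (hn : 0 < n) (hδ : 0 < δ)
    (hK : 0 < K) (hJ : 0 < J) (I : Fin K → ℕ) (hI : ∀ k, 0 < I k)
    (A : Matrix (Fin M) (Fin m) ℝ)
    (B C D : Matrix (Fin M) (Fin n × Fin δ) ℝ)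
    (a : Fin m → ℝ) (b c d : Fin n × Fin δ → ℝ)
    (f : Fin M → ℝ) (L U : ℝ) (hLU : L ≤ U)
    (Xb : Fin K → Fin δ → ℝ)
    (hXb : ∀ k h, Xb k h = 0 ∨ Xb k h = 1)
    (Vb : (k : Fin K) → Fin (I k) → Fin δ → ℝ)
    (hVb : ∀ k j h, L * Xb k h ≤ Vb k j h ∧ Vb k j h ≤ U * Xb k h)
    (Wb : Fin J → Fin δ → ℝ)
    (hWb : ∀ j h, 0 ≤ Wb j h)
    (Zsemi Zmilp : Set ℝ)
    (hZsemi : Zsemi = {z : ℝ | ∃ (y : Fin m → ℝ) (xb : Fin n → Fin K → ℝ)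
        (vb : Fin n → (k : Fin K) → Fin (I k) → ℝ) (wb : Fin n → Fin J → ℝ),
        ((∀ r, y r = 0 ∨ y r = 1) ∧
         (∀ i k, xb i k = 0 ∨ xb i k = 1) ∧ (∀ i, ∑ k, xb i k ≤ 1) ∧
         (∀ i k j, 0 ≤ vb i k j ∧ vb i k j ≤ 1) ∧
         (∀ i k, ∑ j, vb i k j = xb i k) ∧
         (∀ i, ∑ k, ∑ j, vb i k j ≤ 1) ∧
         (∀ i j, 0 ≤ wb i j ∧ wb i j ≤ 1) ∧ (∀ i, ∑ j, wb i j ≤ 1) ∧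
         (∀ r, A.mulVec y r
            + (∑ i, ∑ k, xb i k * ∑ h, B r (i, h) * Xb k h)
            + (∑ i, ∑ k, ∑ j, vb i k j * ∑ h, C r (i, h) * Vb k j h)
            + (∑ i, ∑ j, wb i j * ∑ h, D r (i, h) * Wb j h) ≤ f r)) ∧
        z = (∑ r, a r * y r)
            + (∑ i, ∑ k, xb i k * ∑ h, b (i, h) * Xb k h)
            + (∑ i, ∑ k, ∑ j, vb i k j * ∑ h, c (i, h) * Vb k j h)
            + (∑ i, ∑ j, wb i j * ∑ h, d (i, h) * Wb j h)})
    (hZmilp : Zmilp = {z : ℝ | ∃ (y : Fin m → ℝ) (x v w : Fin n × Fin δ → ℝ),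
        ((∀ r, y r = 0 ∨ y r = 1) ∧ (∀ p, x p = 0 ∨ x p = 1) ∧
         (∀ p, L * x p ≤ v p ∧ v p ≤ U * x p) ∧ (∀ p, 0 ≤ w p) ∧
         (∀ r, A.mulVec y r + B.mulVec x r + C.mulVec v r + D.mulVec w r ≤ f r)) ∧
        z = (∑ r, a r * y r) + (∑ p, b p * x p) + (∑ p, c p * v p) + (∑ p, d p * w p)}) :
    Zsemi.Nonempty → BddBelow Zmilp → sInf Zmilp ≤ sInf Zsemi := by
  intro hne hbdd
  refine csInf_le_csInf hbdd hne ?_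
  subst hZsemi hZmilp
  rintro z ⟨y, xb, vb, wb, ⟨hy, hxb, hxbsum, hvb, hvbsum, -, hwb, -, hfeas⟩, rfl⟩
  refine ⟨y, fun p => ∑ k, xb p.1 k * Xb k p.2, fun p => ∑ k, ∑ j, vb p.1 k j * Vb k j p.2,
    fun p => ∑ j, wb p.1 j * Wb j p.2, ⟨hy, fun p => ?_, fun p => ?_, fun p => ?_, fun r => ?_⟩,
    ?_⟩
  · rcases eq_zero_or_exists_eq_single_of_sum_le_one (hxb p.1) (hxbsum p.1) with h | ⟨k, h⟩
    · simp [h]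
    · simpa [h, Pi.single_apply] using hXb k p.2
  · simp only [← hvbsum, Finset.sum_mul, Finset.mul_sum]
    constructor <;> refine Finset.sum_le_sum fun k _ => Finset.sum_le_sum fun j _ => ?_
    · rw [mul_left_comm]
      exact mul_le_mul_of_nonneg_left (hVb k j p.2).1 (hvb p.1 k j).1
    · rw [mul_left_comm]
      exact mul_le_mul_of_nonneg_left (hVb k j p.2).2 (hvb p.1 k j).1
  · exact Finset.sum_nonneg fun j _ => mul_nonneg (hwb p.1 j).1 (hWb j p.2)
  · have hr := hfeas r
    rw [← sum_mul_profile_combination (B r) xb Xb,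
      ← sum_mul_sigma_profile_combination (C r) vb Vb,
      ← sum_mul_profile_combination (D r) wb Wb] at hr
    exact hr
  · rw [sum_mul_profile_combination b xb Xb, sum_mul_sigma_profile_combination c vb Vb,
      sum_mul_profile_combination d wb Wb]
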